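/- (Bernstein–Doetsch-type theorem) Let h : (0,∞) → (0,∞) be a continuous super-multiplicative function satisfying h(t) ≥ t for all t > 0, which is bounded above on (0,1] by a constant M′. Let f : (a,b) → ℝ be an h-mid-convex function. If there exist x₀ ∈ (a,b) and a neighborhood of x₀ contained in (a,b) on which f is bounded above by a constant M, then f is continuous on (a,b). -/

import Mathlib

/-- A super-multiplicative function on the positive reals which dominates the identity
is the identity. -/
theorem eq_self_of_supermultiplicative_of_le {h : ℝ → ℝ}
    (h_supermul : ∀ x y : ℝ, 0 < x → 0 < y → h x * h y ≤ h (x * y))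
    (h_ge : ∀ t : ℝ, 0 < t → t ≤ h t) {t : ℝ} (ht : 0 < t) : h t = t := by
  have h_one : h 1 ≤ 1 := by
    have h₁ := h_supermul 1 1 one_pos one_pos
    rw [mul_one] at h₁
    nlinarith [h_ge 1 one_pos]
  have h_inv : h t * h t⁻¹ ≤ 1 := by
    have h₁ := h_supermul t t⁻¹ ht (inv_pos.2 ht)
    rw [mul_inv_cancel₀ ht.ne'] at h₁
    exact h₁.trans h_one
  have h_mul : h t * t⁻¹ ≤ 1 :=
    (mul_le_mul_of_nonneg_left (h_ge _ (inv_pos.2 ht)) (ht.le.trans (h_ge t ht))).trans h_inv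
  refine le_antisymm ?_ (h_ge t ht)
  rwa [← div_eq_mul_inv, div_le_one ht] at h_mul

/-- A midpoint convex function satisfies the convexity inequality with weights
`1 - 2⁻ⁿ` and `2⁻ⁿ`. -/
theorem midpoint_convex_half_pow {s : Set ℝ} (hs : Convex ℝ s) {f : ℝ → ℝ}
    (hf : ∀ x ∈ s, ∀ y ∈ s, f ((x + y) / 2) ≤ (f x + f y) / 2)
    (n : ℕ) {z w : ℝ} (hz : z ∈ s) (hw : w ∈ s) :
    f (z + (1 / 2) ^ n * (w - z)) ≤ f z + (1 / 2) ^ n * (f w - f z) := by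
  induction n with
  | zero => simp
  | succ n ih =>
    have hmem : z + (1 / 2 : ℝ) ^ n * (w - z) ∈ s :=
      hs.add_smul_sub_mem hz hw
        ⟨by positivity, pow_le_one₀ (by norm_num) (by norm_num)⟩
    have hmid := hf z hz _ hmem
    have heq : z + (1 / 2 : ℝ) ^ (n + 1) * (w - z)
        = (z + (z + (1 / 2 : ℝ) ^ n * (w - z))) / 2 := by ring
    rw [heq, pow_succ]
    linarith

/-- A midpoint convex function on an open interval which is bounded above near one point is
bounded above near every point. -/
theorem midpoint_convex_bddAbove_ball {a b : ℝ} {f : ℝ → ℝ}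
    (hf : ∀ x ∈ Set.Ioo a b, ∀ y ∈ Set.Ioo a b, f ((x + y) / 2) ≤ (f x + f y) / 2)
    {x₀ r M : ℝ} (hr : 0 < r)
    (hball : ∀ x ∈ Metric.ball x₀ r, x ∈ Set.Ioo a b ∧ f x ≤ M)
    {y : ℝ} (hy : y ∈ Set.Ioo a b) :
    ∃ δ > 0, ∃ K, ∀ x ∈ Metric.ball y δ, x ∈ Set.Ioo a b ∧ f x ≤ K := by
  have hpow : Filter.Tendsto (fun n : ℕ => (1 / 2 : ℝ) ^ n) Filter.atTop (nhds 0) :=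
    tendsto_pow_atTop_nhds_zero_of_lt_one (by norm_num) (by norm_num)
  have hcont : ContinuousAt (fun t : ℝ => (y - t * x₀) / (1 - t)) 0 :=
    ContinuousAt.div (by fun_prop) (by fun_prop) (by norm_num)
  have hlim : Filter.Tendsto (fun n : ℕ => (y - (1 / 2 : ℝ) ^ n * x₀) / (1 - (1 / 2 : ℝ) ^ n))
      Filter.atTop (nhds y) := by
    have := hcont.tendsto.comp hpow
    simpa [Function.comp_def] using this
  obtain ⟨n, hz, hlt⟩ := ((hlim.eventually (isOpen_Ioo.mem_nhds hy)).and
    (hpow.eventually (gt_mem_nhds one_pos))).exists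
  set t : ℝ := (1 / 2) ^ n with ht
  have ht_pos : 0 < t := by positivity
  set z : ℝ := (y - t * x₀) / (1 - t) with hz_def
  have hyz : z * (1 - t) = y - t * x₀ := div_mul_cancel₀ _ (by linarith)
  refine ⟨t * r, by positivity, f z + t * (M - f z), fun x hx => ?_⟩
  rw [Metric.mem_ball, Real.dist_eq] at hx
  have hw : x₀ + (x - y) / t ∈ Metric.ball x₀ r := by
    rw [Metric.mem_ball, Real.dist_eq, add_sub_cancel_left, abs_div, abs_of_pos ht_pos,
      div_lt_iff₀ ht_pos]
    linarith
  obtain ⟨hw_mem, hw_le⟩ := hball _ hw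
  have hx_eq : z + t * (x₀ + (x - y) / t - z) = x := by
    have : t * ((x - y) / t) = x - y := mul_div_cancel₀ _ ht_pos.ne'
    linear_combination this + hyz
  constructor
  · have := (convex_Ioo a b).add_smul_sub_mem hz hw_mem ⟨ht_pos.le, hlt.le⟩
    rwa [smul_eq_mul, hx_eq] at this
  · have := midpoint_convex_half_pow (convex_Ioo a b) hf n hz hw_mem
    rw [← ht, hx_eq] at this
    have := mul_le_mul_of_nonneg_left hw_le ht_pos.le
    linarith

/-- A midpoint convex function is continuous at the centre of a ball on which it is
bounded above. -/
theorem midpoint_convex_continuousAt {s : Set ℝ} (hs : Convex ℝ s) {f : ℝ → ℝ}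
    (hf : ∀ x ∈ s, ∀ y ∈ s, f ((x + y) / 2) ≤ (f x + f y) / 2)
    {x r M : ℝ} (hr : 0 < r) (hball : ∀ y ∈ Metric.ball x r, y ∈ s ∧ f y ≤ M) :
    ContinuousAt f x := by
  have hx : x ∈ s := (hball x (Metric.mem_ball_self hr)).1
  rw [Metric.continuousAt_iff]
  intro ε hε
  have hlim : Filter.Tendsto (fun n : ℕ => (1 / 2 : ℝ) ^ n * (M - f x)) Filter.atTop (nhds 0) := by
    simpa using (tendsto_pow_atTop_nhds_zero_of_lt_one (r := (1 / 2 : ℝ))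
      (by norm_num) (by norm_num)).mul_const (M - f x)
  obtain ⟨n, hn⟩ := (hlim.eventually (gt_mem_nhds hε)).exists
  set t : ℝ := (1 / 2) ^ n with ht
  have ht_pos : 0 < t := by positivity
  have ht_le : t ≤ 1 := pow_le_one₀ (by norm_num) (by norm_num)
  have upper : ∀ u, |u| < t * r → x + u ∈ s ∧ f (x + u) < f x + ε := by
    intro u hu
    have hw : x + u / t ∈ Metric.ball x r := by
      rw [Metric.mem_ball, Real.dist_eq, add_sub_cancel_left, abs_div, abs_of_pos ht_pos,
        div_lt_iff₀ ht_pos]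
      linarith
    obtain ⟨hw_mem, hw_le⟩ := hball _ hw
    have hx_eq : x + t * (x + u / t - x) = x + u := by
      rw [add_sub_cancel_left, mul_div_cancel₀ _ ht_pos.ne']
    constructor
    · have := hs.add_smul_sub_mem hx hw_mem ⟨ht_pos.le, ht_le⟩
      rwa [smul_eq_mul, hx_eq] at this
    · have := midpoint_convex_half_pow hs hf n hx hw_mem
      rw [← ht, hx_eq] at this
      have := mul_le_mul_of_nonneg_left hw_le ht_pos.le
      linarith
  refine ⟨t * r, by positivity, fun {y} hy => ?_⟩
  rw [Real.dist_eq] at hy ⊢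
  obtain ⟨h₁, h₂⟩ := upper (y - x) hy
  obtain ⟨h₃, h₄⟩ := upper (-(y - x)) (by rwa [abs_neg])
  have hmid := hf _ h₁ _ h₃
  rw [show (x + (y - x) + (x + -(y - x))) / 2 = x by ring] at hmid
  rw [add_sub_cancel] at h₂ hmid
  rw [abs_lt]
  constructor <;> linarith

theorem bernstein_doetsch_for_h_mid_convex
    (a b M M' : ℝ) (h f : ℝ → ℝ)
    (h_pos : ∀ t : ℝ, 0 < t → 0 < h t)
    (h_cont : ContinuousOn h (Set.Ioi (0 : ℝ)))
    (h_supermul : ∀ x y : ℝ, 0 < x → 0 < y → h x * h y ≤ h (x * y))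
    (h_ge : ∀ t : ℝ, 0 < t → t ≤ h t)
    (h_bdd : ∀ t ∈ Set.Ioc (0 : ℝ) 1, h t ≤ M')
    (f_midconv : ∀ x ∈ Set.Ioo a b, ∀ y ∈ Set.Ioo a b,
      f ((x + y) / 2) ≤ h (1 / 2) * (f x + f y))
    (f_locbdd : ∃ x₀ ∈ Set.Ioo a b, ∃ U ∈ nhds x₀,
      U ⊆ Set.Ioo a b ∧ ∀ x ∈ U, f x ≤ M) :
    ContinuousOn f (Set.Ioo a b) := by
  have hf : ∀ x ∈ Set.Ioo a b, ∀ y ∈ Set.Ioo a b, f ((x + y) / 2) ≤ (f x + f y) / 2 := by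
    intro x hx y hy
    have hmid := f_midconv x hx y hy
    rw [eq_self_of_supermultiplicative_of_le h_supermul h_ge one_half_pos] at hmid
    linarith
  obtain ⟨x₀, -, U, hU, hU_sub, hU_le⟩ := f_locbdd
  obtain ⟨r, hr, hrU⟩ := Metric.mem_nhds_iff.1 hU
  intro y hy
  obtain ⟨δ, hδ, K, hK⟩ := midpoint_convex_bddAbove_ball hf hr
    (fun x hx => ⟨hU_sub (hrU hx), hU_le x (hrU hx)⟩) hy
  exact (midpoint_convex_continuousAt (convex_Ioo a b) hf hδ hK).continuousWithinAt
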